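/- (Second welfare theorem.) Assume each utility u_i is continuous, strictly increasing, quasiconcave, and differentiable on the interior of ℝ_{≥0}^K. If x ∈ F(w) is Pareto optimal, then there exists a price vector p ∈ Σ_K^+(w) such that (x,p) is a Walrasian equilibrium with income distribution m = (⟨p,x_1⟩,…,⟨p,x_N⟩) ∈ Σ_N. -/

import Mathlib

/-- Euclidean inner product on `ℝ^K`. -/
noncomputable def dot {K : ℕ} (p x : Fin K → ℝ) : ℝ := ∑ k, p k * x k

/-- Membership in the nonnegative orthant `ℝ_{≥0}^K`. -/
def nonneg {K : ℕ} (x : Fin K → ℝ) : Prop := ∀ k, 0 ≤ x k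

/-- Strictly positive price vector. -/
def posVec {K : ℕ} (p : Fin K → ℝ) : Prop := ∀ k, 0 < p k

/-- `v` is the indirect utility of `u`: for every strictly positive price `p` and income
`m ≥ 0`, `v p m` is the maximum of `u` over the budget set
`{x ∈ ℝ_{≥0}^K : ⟨p,x⟩ ≤ m}`. -/
def IsIndirectUtility {K : ℕ} (u : (Fin K → ℝ) → ℝ) (v : (Fin K → ℝ) → ℝ → ℝ) : Prop :=
  ∀ p m, posVec p → 0 ≤ m →
    IsGreatest {t | ∃ x, nonneg x ∧ dot p x ≤ m ∧ u x = t} (v p m)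

/-- The set of feasible allocations `F(w)`. -/
def Feasible {K N : ℕ} (w : Fin K → ℝ) (x : Fin N → Fin K → ℝ) : Prop :=
  (∀ i, nonneg (x i)) ∧ ∀ k, (∑ i, x i k) ≤ w k

/-- Normalized strictly positive prices `Σ_K^+(w)`. -/
def PriceSimplex {K : ℕ} (w p : Fin K → ℝ) : Prop := posVec p ∧ dot p w = 1

/-- Income distributions `Σ_N`. -/
def IncomeSimplex {N : ℕ} (m : Fin N → ℝ) : Prop := (∀ i, 0 ≤ m i) ∧ (∑ i, m i) = 1

/-- The utility possibility set. -/
def UPS {K N : ℕ} (w : Fin K → ℝ) (u : Fin N → (Fin K → ℝ) → ℝ) : Set (Fin N → ℝ) :=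
  {e | ∃ x, Feasible w x ∧ ∀ i, e i = u i (x i)}

/-- The indirect utility possibility set. -/
def VPS {K N : ℕ} (w : Fin K → ℝ) (v : Fin N → (Fin K → ℝ) → ℝ → ℝ) : Set (Fin N → ℝ) :=
  {e | ∃ p m, PriceSimplex w p ∧ IncomeSimplex m ∧ ∀ i, e i = v i p (m i)}

/-- A Walrasian equilibrium with income distribution `m`. -/
def WalrasEq {K N : ℕ} (w : Fin K → ℝ) (u : Fin N → (Fin K → ℝ) → ℝ)
    (v : Fin N → (Fin K → ℝ) → ℝ → ℝ)
    (x : Fin N → Fin K → ℝ) (p : Fin K → ℝ) (m : Fin N → ℝ) : Prop :=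
  Feasible w x ∧ PriceSimplex w p ∧ ∀ i, dot p (x i) = m i ∧ u i (x i) = v i p (m i)

/-- Pareto optimality of an allocation `x ∈ F(w)`. -/
def ParetoOptimal {K N : ℕ} (w : Fin K → ℝ) (u : Fin N → (Fin K → ℝ) → ℝ)
    (x : Fin N → Fin K → ℝ) : Prop :=
  Feasible w x ∧
    ¬ ∃ x', Feasible w x' ∧ (∀ i, u i (x i) ≤ u i (x' i)) ∧ ∃ j, u j (x j) < u j (x' j)

theorem dot_add {K : ℕ} (p x y : Fin K → ℝ) : dot p (x + y) = dot p x + dot p y :=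
  dotProduct_add p x y

theorem dot_smul {K : ℕ} (p : Fin K → ℝ) (t : ℝ) (x : Fin K → ℝ) :
    dot p (t • x) = t * dot p x :=
  dotProduct_smul t p x

theorem dot_sum {K N : ℕ} (p : Fin K → ℝ) (x : Fin N → Fin K → ℝ) :
    dot p (∑ i, x i) = ∑ i, dot p (x i) :=
  dotProduct_sum p Finset.univ x

theorem dot_single {K : ℕ} (p : Fin K → ℝ) (k : Fin K) : dot p (Pi.single k 1) = p k :=
  dotProduct_single_one p k

/-- Every continuous linear functional on `ℝ^K` is the pairing with a vector. -/
theorem exists_dot_eq {K : ℕ} (f : (Fin K → ℝ) →L[ℝ] ℝ) : ∃ p, ∀ z, f z = dot p z := by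
  refine ⟨fun k => f (Pi.single k 1), fun z => ?_⟩
  conv_lhs => rw [pi_eq_sum_univ' z, map_sum]
  simp [dot, mul_comm]

theorem dot_nonneg {K : ℕ} {p x : Fin K → ℝ} (hp : posVec p) (hx : nonneg x) : 0 ≤ dot p x :=
  Finset.sum_nonneg fun k _ => mul_nonneg (hp k).le (hx k)

theorem eq_zero_of_dot_nonpos {K : ℕ} {p x : Fin K → ℝ} (hp : posVec p) (hx : nonneg x)
    (h : dot p x ≤ 0) : x = 0 := by
  have h0 : dot p x = 0 := le_antisymm h (dot_nonneg hp hx)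
  ext k
  have := (Finset.sum_eq_zero_iff_of_nonneg fun k _ => mul_nonneg (hp k).le (hx k)).1 h0 k
    (Finset.mem_univ k)
  exact (mul_eq_zero.1 this).resolve_left (hp k).ne'

/-- If preferences are strictly monotone, an allocation that is weakly preferred by everybody to a
Pareto optimal one and uses no more than the endowment exhausts the endowment. -/
theorem ParetoOptimal.sum_eq {K N : ℕ} (hN : 1 ≤ N) {w : Fin K → ℝ}
    {u : Fin N → (Fin K → ℝ) → ℝ}
    (hu_mono : ∀ i x y, nonneg x → nonneg y → (∀ k, x k ≤ y k) → x ≠ y → u i x < u i y)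
    {x : Fin N → Fin K → ℝ} (hx : ParetoOptimal w u x) {y : Fin N → Fin K → ℝ}
    (hy : ∀ i, nonneg (y i)) (huy : ∀ i, u i (x i) ≤ u i (y i)) (hyw : ∑ i, y i ≤ w) :
    ∑ i, y i = w := by
  by_contra hne
  let j : Fin N := ⟨0, hN⟩
  let d : Fin K → ℝ := w - ∑ i, y i
  have hd : 0 ≤ d := sub_nonneg.2 hyw
  have hd0 : d ≠ 0 := sub_ne_zero.2 (Ne.symm hne)
  have hj : u j (y j) < u j (y j + d) :=
    hu_mono j _ _ (hy j) (fun k => add_nonneg (hy j k) (hd k))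
      (fun k => le_add_of_nonneg_right (hd k)) (by simpa using hd0)
  refine hx.2 ⟨y + Pi.single j d, ⟨fun i k => ?_, fun k => ?_⟩, fun i => ?_, j, ?_⟩
  · rcases eq_or_ne i j with rfl | hij
    · simpa using add_nonneg (hy j k) (hd k)
    · simpa [hij] using hy i k
  · have h : ∑ i, (y + Pi.single j d : Fin N → Fin K → ℝ) i = w := by
      simp [Finset.sum_add_distrib, d]
    have := congrFun h k
    rw [Finset.sum_apply] at this
    exact this.le
  · rcases eq_or_ne i j with rfl | hij
    · simpa using (huy j).trans hj.le
    · simpa [hij] using huy i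
  · simpa using (huy j).trans_lt hj

/-- A Pareto optimal allocation is supported by a price vector at which each consumer's bundle
minimizes expenditure over the weakly preferred bundles. -/
theorem ParetoOptimal.exists_expenditure_minimizing {K N : ℕ} (hK : 1 ≤ K) (hN : 1 ≤ N)
    {w : Fin K → ℝ} (hw : posVec w) {u : Fin N → (Fin K → ℝ) → ℝ}
    (hu_mono : ∀ i x y, nonneg x → nonneg y → (∀ k, x k ≤ y k) → x ≠ y → u i x < u i y)
    (hu_qc : ∀ i (c : ℝ), Convex ℝ {x | nonneg x ∧ c ≤ u i x})
    {x : Fin N → Fin K → ℝ} (hx : ParetoOptimal w u x) :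
    ∃ p, dot p w = 1 ∧ ∀ i y, nonneg y → u i (x i) ≤ u i y → dot p (x i) ≤ dot p y := by
  let U : Set (Fin N → Fin K → ℝ) := Set.univ.pi fun i => {y | nonneg y ∧ u i (x i) ≤ u i y}
  have hU : Convex ℝ U := convex_pi fun i _ => hu_qc i _
  let L : (Fin N → Fin K → ℝ) →ₗ[ℝ] (Fin K → ℝ) := ∑ i, LinearMap.proj i
  have hL : ∀ y, L y = ∑ i, y i := fun y => by simp [L]
  let T : Set (Fin K → ℝ) := Set.univ.pi fun k => Set.Iio (w k)
  have hTo : IsOpen T := isOpen_set_pi Set.finite_univ fun k _ => isOpen_Iio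
  have hTc : Convex ℝ T := convex_pi fun k _ => convex_Iio (w k)
  have hxU : x ∈ U := fun i _ => ⟨hx.1.1 i, le_rfl⟩
  have hxw : ∑ i, x i = w := hx.sum_eq hN hu_mono hx.1.1 (fun _ => le_rfl) fun k => by
    simpa using hx.1.2 k
  have hdisj : Disjoint T (L '' U) := by
    rw [Set.disjoint_left]
    rintro _ hz ⟨y, hy, rfl⟩
    rw [hL] at hz
    have h := hx.sum_eq hN hu_mono (fun i => (hy i trivial).1) (fun i => (hy i trivial).2)
      fun k => (hz k trivial).le
    rw [h] at hz
    exact lt_irrefl (w ⟨0, hK⟩) (hz ⟨0, hK⟩ trivial)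
  obtain ⟨f, c, hfT, hfU⟩ := geometric_hahn_banach_open hTc hTo (hU.linear_image L) hdisj
  have hc : 0 < c := by simpa using hfT 0 fun k _ => hw k
  have hcw : c ≤ f w := by simpa [hL, hxw] using hfU _ ⟨x, hxU, rfl⟩
  have hfw : f w = c := by
    refine le_antisymm (le_of_not_gt fun h => ?_) hcw
    have hlt : c / f w < 1 := (div_lt_one (hc.trans h)).2 h
    have := hfT ((c / f w) • w) fun k _ => mul_lt_of_lt_one_left (hw k) hlt
    rw [map_smul, smul_eq_mul, div_mul_cancel₀ _ (hc.trans h).ne'] at this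
    exact lt_irrefl _ this
  obtain ⟨p, hp⟩ := exists_dot_eq (c⁻¹ • f)
  refine ⟨p, ?_, fun i y hy hiy => ?_⟩
  · rw [← hp]
    simp [hfw, hc.ne']
  · have hmem : Function.update x i y ∈ U := fun j _ => by
      rcases eq_or_ne j i with rfl | hj
      · simpa using ⟨hy, hiy⟩
      · simpa [hj] using hxU j trivial
    have hsum : L (Function.update x i y) = w - x i + y := by
      rw [hL, Finset.sum_update_of_mem (Finset.mem_univ i), ← hxw,
        ← Finset.sum_sdiff (Finset.subset_univ {i}), Finset.sum_singleton]
      abel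
    have h := hfU _ ⟨_, hmem, rfl⟩
    rw [hsum, map_add, map_sub, hfw] at h
    rw [← hp, ← hp]
    have hle : f (x i) ≤ f y := by linarith
    exact mul_le_mul_of_nonneg_left hle (inv_nonneg.2 hc.le)

/-- An expenditure minimizing bundle of positive cost is cheaper than every strictly preferred
bundle. -/
theorem dot_lt_of_expenditure_minimizing {K : ℕ} {u : (Fin K → ℝ) → ℝ}
    (hu : ContinuousOn u {x | nonneg x}) {p x : Fin K → ℝ}
    (hmin : ∀ y, nonneg y → u x ≤ u y → dot p x ≤ dot p y) (hpos : 0 < dot p x)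
    {y : Fin K → ℝ} (hy : nonneg y) (hxy : u x < u y) : dot p x < dot p y := by
  have hcont : ContinuousWithinAt (fun t : ℝ => u (t • y)) (Set.Ici 0) 1 := by
    refine ContinuousWithinAt.comp (t := {x | nonneg x}) (hu _ ?_) (by fun_prop) ?_
    · simpa using hy
    · exact fun t ht k => mul_nonneg ht (hy k)
  have hcont' : ContinuousAt (fun t : ℝ => u (t • y)) 1 :=
    hcont.continuousAt (Ici_mem_nhds one_pos)
  have hev : ∀ᶠ t : ℝ in nhds 1, u x < u (t • y) ∧ 0 < t :=
    (hcont'.eventually (lt_mem_nhds (by simpa using hxy))).and (lt_mem_nhds one_pos)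
  obtain ⟨t, ht1, hut, ht0⟩ :=
    ((frequently_lt_nhds (1 : ℝ)).and_eventually hev).exists
  have h := hmin (t • y) (fun k => mul_nonneg ht0.le (hy k)) hut.le
  rw [dot_smul] at h
  nlinarith

/-- Second welfare theorem: every Pareto optimal allocation is part of a
Walrasian equilibrium whose income distribution is given by the cost of the allocation at
the equilibrium prices. -/
theorem second_welfare_theorem {K N : ℕ} (hK : 1 ≤ K) (hN : 1 ≤ N)
    (w : Fin K → ℝ) (hw : posVec w)
    (u : Fin N → (Fin K → ℝ) → ℝ)
    (hu_cont : ∀ i, ContinuousOn (u i) {x | nonneg x})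
    (hu_mono : ∀ i x y, nonneg x → nonneg y → (∀ k, x k ≤ y k) → x ≠ y → u i x < u i y)
    (hu_qc : ∀ i (c : ℝ), Convex ℝ {x | nonneg x ∧ c ≤ u i x})
    (hu_diff : ∀ i, DifferentiableOn ℝ (u i) {x | posVec x})
    (v : Fin N → (Fin K → ℝ) → ℝ → ℝ)
    (hv : ∀ i, IsIndirectUtility (u i) (v i)) :
    ∀ x, ParetoOptimal w u x →
      ∃ p, IncomeSimplex (fun i => dot p (x i)) ∧
        WalrasEq w u v x p (fun i => dot p (x i)) := by
  intro x hx
  obtain ⟨p, hpw, hmin⟩ := hx.exists_expenditure_minimizing hK hN hw hu_mono hu_qc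
  have hxw : ∑ i, x i = w := hx.sum_eq hN hu_mono hx.1.1 (fun _ => le_rfl) fun k => by
    simpa using hx.1.2 k
  have hsum : ∑ i, dot p (x i) = 1 := by rw [← dot_sum, hxw, hpw]
  obtain ⟨j, -, hj⟩ : ∃ j ∈ Finset.univ, 0 < dot p (x j) := by
    by_contra! h
    linarith [Finset.sum_nonpos h]
  have hp : posVec p := fun k => by
    have he : 0 ≤ (Pi.single k 1 : Fin K → ℝ) := Pi.single_nonneg.2 zero_le_one
    have hy : nonneg (x j + Pi.single k 1) := fun l => add_nonneg (hx.1.1 j l) (he l)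
    have h := dot_lt_of_expenditure_minimizing (hu_cont j) (hmin j) hj hy <|
      hu_mono j _ _ (hx.1.1 j) hy (fun l => le_add_of_nonneg_right (he l)) (by simp)
    rw [dot_add, dot_single] at h
    linarith
  have hm : ∀ i, 0 ≤ dot p (x i) := fun i => dot_nonneg hp (hx.1.1 i)
  refine ⟨p, ⟨hm, hsum⟩, hx.1, ⟨hp, hpw⟩, fun i => ⟨rfl, ?_⟩⟩
  obtain ⟨⟨y, hy, hyb, hyv⟩, hmax⟩ := hv i p (dot p (x i)) hp (hm i)
  refine le_antisymm (hmax ⟨x i, hx.1.1 i, le_rfl, rfl⟩) ?_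
  rw [← hyv]
  rcases (hm i).eq_or_lt with h0 | hpos
  · rw [eq_zero_of_dot_nonpos hp hy (hyb.trans h0.ge),
      eq_zero_of_dot_nonpos hp (hx.1.1 i) h0.ge]
  · by_contra! hlt
    exact (dot_lt_of_expenditure_minimizing (hu_cont i) (hmin i) hpos hy hlt).not_ge hyb
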